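/- Let 𝒯 be a finite undirected tree, w : V(𝒯) → ℝ≥0 a weight function, and m = w(𝒯). Then cent(𝒯,w) ≤ 2·OPT(𝒯,w) − m; that is, the cost of every centroid tree of (𝒯,w) is at most twice the optimum cost minus the total weight. -/

import Mathlib

open Filter Topology

universe u

variable {V : Type u}

/-- Rooted trees with vertices labelled by elements of `V`. -/
inductive RTree (V : Type u) : Type u where
  | node : V → List (RTree V) → RTree V

namespace RTree

/-- The root of a rooted tree. -/
def root : RTree V → V
  | node r _ => r

/-- The subtrees rooted at the children of the root. -/
def children : RTree V → List (RTree V)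
  | node _ ts => ts

/-- The list of pairs `(v, path from the root to v)` over all vertices `v` of the tree. -/
def pathsFrom : RTree V → List (V × List V)
  | node r ts =>
      (r, [r]) ::
        (ts.attach.map fun t => (t.1.pathsFrom.map fun p => (p.1, r :: p.2))).flatten
  decreasing_by
    simp only [RTree.node.sizeOf_spec]
    have := List.sizeOf_lt_of_mem t.2
    omega

/-- The vertex set of a rooted tree. -/
def vertSet (T : RTree V) : Set V := {v | ∃ p ∈ T.pathsFrom, p.1 = v}

/-- `Path_T(v)`: the set of vertices on the path in `T` from the root to `v`
(including both endpoints). -/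
def pathSet (T : RTree V) (v : V) : Set V := {x | ∃ p ∈ T.pathsFrom, p.1 = v ∧ x ∈ p.2}

/-- The depth of a vertex `v` in `T`; the root has depth 1. -/
noncomputable def depth (T : RTree V) (v : V) : ℕ := (T.pathSet v).ncard

/-- All subtrees of a rooted tree (including the tree itself). -/
def allSubtrees : RTree V → List (RTree V)
  | node r ts => node r ts :: (ts.attach.map fun t => t.1.allSubtrees).flatten
  decreasing_by
    simp only [RTree.node.sizeOf_spec]
    have := List.sizeOf_lt_of_mem t.2
    omega

/-- Two rooted trees are equivalent (represent the same search tree) if they have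
the same root-to-vertex paths. -/
def Equiv (T₁ T₂ : RTree V) : Prop := ∀ v, T₁.pathSet v = T₂.pathSet v

end RTree

/-- `x` and `y` are joined by a walk of `G` staying inside `s`. -/
def ReachIn (G : SimpleGraph V) (s : Set V) (x y : V) : Prop :=
  ∃ p : G.Walk x y, ∀ v ∈ p.support, v ∈ s

/-- The connected component of `x` in the subgraph of `G` induced by `s`. -/
def compIn (G : SimpleGraph V) (s : Set V) (x : V) : Set V := {y | ReachIn G s x y}

/-- The set of connected components of the subgraph of `G` induced by `s`. -/
def comps (G : SimpleGraph V) (s : Set V) : Set (Set V) := {c | ∃ x ∈ s, c = compIn G s x}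

/-- `s` induces a (nonempty) connected subgraph of `G`. -/
def ConnIn (G : SimpleGraph V) (s : Set V) : Prop :=
  s.Nonempty ∧ ∀ x ∈ s, ∀ y ∈ s, ReachIn G s x y

/-- The total weight of a set of vertices. -/
noncomputable def wsum (w : V → ℝ) (s : Set V) : ℝ := ∑ᶠ x ∈ s, w x

/-- `IsSearchTree G s T`: `T` is a search tree on the subgraph of `G` induced by `s`.
Its root `r` is a vertex of `s`, its vertex set is `s`, and the subtrees rooted at the
children of `r` are search trees on the connected components of the induced subgraph
on `s \ {r}` (one subtree for each component). -/
inductive IsSearchTree (G : SimpleGraph V) : Set V → RTree V → Prop where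
  | node {s : Set V} {r : V} {ts : List (RTree V)} :
      r ∈ s →
      (RTree.node r ts).vertSet = s →
      (∀ t ∈ ts, IsSearchTree G (compIn G (s \ {r}) t.root) t) →
      ts.Pairwise (fun t₁ t₂ => compIn G (s \ {r}) t₁.root ≠ compIn G (s \ {r}) t₂.root) →
      IsSearchTree G s (RTree.node r ts)

/-- The cost of a search tree: `∑_x w(x) · depth(x)`, the root having depth 1. -/
noncomputable def cost (w : V → ℝ) (T : RTree V) : ℝ :=
  ∑ᶠ v ∈ T.vertSet, w v * (T.depth v : ℝ)

/-- The optimum cost of a search tree on the subgraph of `G` induced by `s`. -/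
noncomputable def OPT (G : SimpleGraph V) (w : V → ℝ) (s : Set V) : ℝ :=
  sInf (cost w '' {T | IsSearchTree G s T})

/-- `v` is an `α`-centroid of the subgraph of `G` induced by `s` (with weights `w`):
every connected component of the induced subgraph on `s \ {v}` has weight at most
`α` times the weight of `s`. -/
def IsAlphaCentroid (G : SimpleGraph V) (w : V → ℝ) (α : ℝ) (s : Set V) (v : V) : Prop :=
  v ∈ s ∧ ∀ x ∈ s \ {v}, wsum w (compIn G (s \ {v}) x) ≤ α * wsum w s

/-- `v` is a centroid of the subgraph of `G` induced by `s` (with weights `w`). -/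
def IsCentroid (G : SimpleGraph V) (w : V → ℝ) (s : Set V) (v : V) : Prop :=
  v ∈ s ∧ ∀ x ∈ s \ {v}, wsum w (compIn G (s \ {v}) x) ≤ wsum w s / 2

/-- `T` is an `α`-centroid tree on the subgraph of `G` induced by `s`. -/
def IsAlphaCentroidTree (G : SimpleGraph V) (w : V → ℝ) (α : ℝ) (s : Set V) (T : RTree V) :
    Prop :=
  IsSearchTree G s T ∧ ∀ t ∈ T.allSubtrees, IsAlphaCentroid G w α t.vertSet t.root

/-- `T` is a centroid tree on the subgraph of `G` induced by `s`. -/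
def IsCentroidTree (G : SimpleGraph V) (w : V → ℝ) (s : Set V) (T : RTree V) : Prop :=
  IsSearchTree G s T ∧ ∀ t ∈ T.allSubtrees, IsCentroid G w t.vertSet t.root

/-- `cent(𝒯,w)`: the maximum cost of a centroid tree. -/
noncomputable def centCost (G : SimpleGraph V) (w : V → ℝ) (s : Set V) : ℝ :=
  sSup (cost w '' {T | IsCentroidTree G w s T})

/-- `centᵅ(𝒯,w)`: the maximum cost of an `α`-centroid tree (`0` if none exists, since
`sSup ∅ = 0` in `ℝ`). -/
noncomputable def centCostA (G : SimpleGraph V) (w : V → ℝ) (α : ℝ) (s : Set V) : ℝ :=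
  sSup (cost w '' {T | IsAlphaCentroidTree G w α s T})

/-- `b` is a child of `a` in the rooted tree `T`. -/
def ChildRel (T : RTree V) (a b : V) : Prop :=
  ∃ t ∈ T.allSubtrees, t.root = a ∧ ∃ t' ∈ t.children, t'.root = b

namespace RTree

lemma mem_pathsFrom_node {r : V} {ts : List (RTree V)} {p : V × List V} :
    p ∈ (node r ts).pathsFrom ↔
      p = (r, [r]) ∨ ∃ t ∈ ts, ∃ q ∈ t.pathsFrom, (q.1, r :: q.2) = p := by
  simp [pathsFrom]

lemma mem_vertSet_node {r v : V} {ts : List (RTree V)} :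
    v ∈ (node r ts).vertSet ↔ v = r ∨ ∃ t ∈ ts, v ∈ t.vertSet := by
  simp only [vertSet, Set.mem_ofPred_eq, mem_pathsFrom_node]
  constructor
  · rintro ⟨p, rfl | ⟨t, ht, q, hq, rfl⟩, rfl⟩
    · exact Or.inl rfl
    · exact Or.inr ⟨t, ht, q, hq, rfl⟩
  · rintro (rfl | ⟨t, ht, q, hq, rfl⟩)
    · exact ⟨_, Or.inl rfl, rfl⟩
    · exact ⟨_, Or.inr ⟨t, ht, q, hq, rfl⟩, rfl⟩

lemma mem_pathSet_node {r v x : V} {ts : List (RTree V)} :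
    x ∈ (node r ts).pathSet v ↔
      (v = r ∧ x = r) ∨ ∃ t ∈ ts, v ∈ t.vertSet ∧ (x = r ∨ x ∈ t.pathSet v) := by
  simp only [pathSet, vertSet, Set.mem_ofPred_eq, mem_pathsFrom_node]
  constructor
  · rintro ⟨p, rfl | ⟨t, ht, q, hq, rfl⟩, rfl, hx⟩
    · exact Or.inl ⟨rfl, by simpa using hx⟩
    · refine Or.inr ⟨t, ht, ⟨q, hq, rfl⟩, ?_⟩
      rcases List.mem_cons.1 hx with h | h
      · exact Or.inl h
      · exact Or.inr ⟨q, hq, rfl, h⟩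
  · rintro (⟨rfl, rfl⟩ | ⟨t, ht, ⟨q, hq, rfl⟩, rfl | ⟨q', hq', h, hx⟩⟩)
    · exact ⟨_, Or.inl rfl, rfl, by simp⟩
    · exact ⟨_, Or.inr ⟨t, ht, q, hq, rfl⟩, rfl, by simp⟩
    · exact ⟨_, Or.inr ⟨t, ht, q', hq', rfl⟩, h, by simp [hx]⟩

lemma root_mem_pathSet {r v : V} {ts : List (RTree V)} (hv : v ∈ (node r ts).vertSet) :
    r ∈ (node r ts).pathSet v := by
  rw [mem_pathSet_node]
  rcases mem_vertSet_node.1 hv with h | ⟨t, ht, h⟩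
  · exact Or.inl ⟨h, rfl⟩
  · exact Or.inr ⟨t, ht, h, Or.inl rfl⟩

lemma pathSet_subset_node {r v : V} {ts : List (RTree V)} {t : RTree V} (ht : t ∈ ts) :
    t.pathSet v ⊆ (node r ts).pathSet v := by
  intro x hx
  obtain ⟨p, hp, hpv, -⟩ := id hx
  exact mem_pathSet_node.2 (Or.inr ⟨t, ht, ⟨p, hp, hpv⟩, Or.inr hx⟩)

lemma self_mem_allSubtrees (T : RTree V) : T ∈ T.allSubtrees := by
  cases T
  simp [allSubtrees]

lemma mem_allSubtrees_node {r : V} {ts : List (RTree V)} {t u : RTree V} (ht : t ∈ ts)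
    (hu : u ∈ t.allSubtrees) : u ∈ (node r ts).allSubtrees := by
  simp only [allSubtrees, List.mem_cons, List.mem_flatten, List.mem_map, List.mem_attach,
    true_and, Subtype.exists]
  exact Or.inr ⟨_, ⟨t, ht, rfl⟩, hu⟩

end RTree

section ReachIn

variable {G : SimpleGraph V} {s : Set V} {x y z : V}

lemma ReachIn.mem_right (h : ReachIn G s x y) : y ∈ s := by
  obtain ⟨p, hp⟩ := h
  exact hp _ p.end_mem_support

lemma ReachIn.symm (h : ReachIn G s x y) : ReachIn G s y x := by
  obtain ⟨p, hp⟩ := h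
  exact ⟨p.reverse, by simpa using hp⟩

lemma ReachIn.trans (h : ReachIn G s x y) (h' : ReachIn G s y z) : ReachIn G s x z := by
  obtain ⟨p, hp⟩ := h
  obtain ⟨q, hq⟩ := h'
  refine ⟨p.append q, fun v hv => ?_⟩
  rcases (SimpleGraph.Walk.mem_support_append_iff p q).1 hv with h | h
  · exact hp v h
  · exact hq v h

lemma ReachIn.mono {s' : Set V} (hs : s ⊆ s') (h : ReachIn G s x y) : ReachIn G s' x y := by
  obtain ⟨p, hp⟩ := h
  exact ⟨p, fun v hv => hs (hp v hv)⟩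

lemma compIn_subset : compIn G s x ⊆ s := fun _ h => ReachIn.mem_right h

lemma compIn_eq_of_mem (h : y ∈ compIn G s x) : compIn G s y = compIn G s x := by
  ext z
  exact ⟨fun hz => ReachIn.trans h hz, fun hz => (ReachIn.symm h).trans hz⟩

lemma ReachIn.in_compIn (h : ReachIn G s x y) : ReachIn G (compIn G s x) x y := by
  classical
  obtain ⟨p, hp⟩ := h
  exact ⟨p, fun v hv => ⟨p.takeUntil v hv,
    fun u hu => hp u (p.support_takeUntil_subset_support hv hu)⟩⟩

lemma connIn_compIn (hx : x ∈ s) : ConnIn G (compIn G s x) :=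
  ⟨⟨x, .nil, by simpa using hx⟩, fun _ hy _ hz =>
    (ReachIn.in_compIn hy).symm.trans (ReachIn.in_compIn hz)⟩

end ReachIn

section IsSearchTree

variable {G : SimpleGraph V} {s : Set V} {T : RTree V}

lemma IsSearchTree.vertSet_eq (h : IsSearchTree G s T) : T.vertSet = s := by
  cases h
  assumption

lemma IsSearchTree.root_mem (h : IsSearchTree G s T) : T.root ∈ s := by
  cases h
  assumption

lemma IsSearchTree.self_mem_pathSet (h : IsSearchTree G s T) : ∀ v ∈ s, v ∈ T.pathSet v := by
  induction h with
  | @node s r ts hr hs hts hpw ih =>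
    intro v hv
    rw [← hs, RTree.mem_vertSet_node] at hv
    rcases hv with rfl | ⟨t, ht, hv⟩
    · exact RTree.mem_pathSet_node.2 (Or.inl ⟨rfl, rfl⟩)
    · exact RTree.pathSet_subset_node ht (ih t ht v ((hts t ht).vertSet_eq ▸ hv))

/-- Every connected set contains a vertex that is an ancestor of the whole set. -/
lemma IsSearchTree.exists_common_ancestor (h : IsSearchTree G s T) {H : Set V}
    (hH : ConnIn G H) (hHs : H ⊆ s) : ∃ a ∈ H, ∀ v ∈ H, a ∈ T.pathSet v := by
  induction h with
  | @node s r ts hr hs hts hpw ih =>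
    by_cases hrH : r ∈ H
    · exact ⟨r, hrH, fun v hv => RTree.root_mem_pathSet (hs ▸ hHs hv)⟩
    obtain ⟨x, hx⟩ := hH.1
    have hxs := hHs hx
    rw [← hs, RTree.mem_vertSet_node] at hxs
    rcases hxs with rfl | ⟨t, ht, hxt⟩
    · exact absurd hx hrH
    rw [(hts t ht).vertSet_eq] at hxt
    have hsub : H ⊆ s \ {r} := fun v hv => ⟨hHs hv, fun h => hrH (h ▸ hv)⟩
    obtain ⟨a, ha, hav⟩ := ih t ht fun v hv =>
      ReachIn.trans hxt ((hH.2 x hx v hv).mono hsub)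
    exact ⟨a, ha, fun v hv => RTree.pathSet_subset_node ht (hav v hv)⟩

end IsSearchTree

section wsum

variable [Finite V] {f g : V → ℝ} {s : Set V}

lemma wsum_mono (h : ∀ v ∈ s, f v ≤ g v) : wsum f s ≤ wsum g s := by
  rw [wsum, wsum, finsum_mem_eq_finite_toFinset_sum _ s.toFinite,
    finsum_mem_eq_finite_toFinset_sum _ s.toFinite]
  exact Finset.sum_le_sum fun v hv => h v (by simpa using hv)

lemma wsum_add (f g : V → ℝ) (s : Set V) :
    wsum (fun v => f v + g v) s = wsum f s + wsum g s :=
  finsum_mem_add_distrib s.toFinite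

end wsum

section children

variable {G : SimpleGraph V} {s : Set V} {r : V} {ts : List (RTree V)}

lemma eq_of_mem_vertSet_children
    (hts : ∀ t ∈ ts, IsSearchTree G (compIn G (s \ {r}) t.root) t)
    (hpw : ts.Pairwise fun t₁ t₂ => compIn G (s \ {r}) t₁.root ≠ compIn G (s \ {r}) t₂.root)
    {t t' : RTree V} (ht : t ∈ ts) (ht' : t' ∈ ts) {v : V} (hv : v ∈ t.vertSet)
    (hv' : v ∈ t'.vertSet) : t = t' := by
  by_contra hne
  have : Std.Symm fun t₁ t₂ : RTree V =>
      compIn G (s \ {r}) t₁.root ≠ compIn G (s \ {r}) t₂.root := ⟨fun _ _ h => h.symm⟩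
  refine hpw.forall ht ht' hne ?_
  rw [(hts t ht).vertSet_eq] at hv
  rw [(hts t' ht').vertSet_eq] at hv'
  rw [← compIn_eq_of_mem hv, ← compIn_eq_of_mem hv']

lemma root_notMem_vertSet_child
    (hts : ∀ t ∈ ts, IsSearchTree G (compIn G (s \ {r}) t.root) t) {t : RTree V} (ht : t ∈ ts) :
    r ∉ t.vertSet := by
  rw [(hts t ht).vertSet_eq]
  exact fun h => (compIn_subset h).2 rfl

lemma wsum_vertSet_node [Finite V] [DecidableEq (RTree V)]
    (hts : ∀ t ∈ ts, IsSearchTree G (compIn G (s \ {r}) t.root) t)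
    (hpw : ts.Pairwise fun t₁ t₂ => compIn G (s \ {r}) t₁.root ≠ compIn G (s \ {r}) t₂.root)
    (f : V → ℝ) :
    wsum f (RTree.node r ts).vertSet = f r + ∑ t ∈ ts.toFinset, wsum f t.vertSet := by
  have hset : (RTree.node r ts).vertSet =
      insert r (⋃ t ∈ (ts.toFinset : Set (RTree V)), t.vertSet) := by
    ext v
    simp [RTree.mem_vertSet_node]
  have hdisj : (ts.toFinset : Set (RTree V)).PairwiseDisjoint RTree.vertSet := by
    intro t ht t' ht' hne
    refine Set.disjoint_left.2 fun v hv hv' => hne ?_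
    exact eq_of_mem_vertSet_children hts hpw (by simpa using ht) (by simpa using ht') hv hv'
  have hr : r ∉ ⋃ t ∈ (ts.toFinset : Set (RTree V)), t.vertSet := by
    simpa using fun t ht => root_notMem_vertSet_child hts ht
  rw [hset, wsum, finsum_mem_insert _ hr (Set.toFinite _),
    finsum_mem_biUnion hdisj (Finset.finite_toSet _) fun t _ => t.vertSet.toFinite,
    finsum_mem_coe_finset]
  rfl

lemma depth_node_root_le
    (hts : ∀ t ∈ ts, IsSearchTree G (compIn G (s \ {r}) t.root) t) :
    (RTree.node r ts).depth r ≤ 1 := by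
  rw [RTree.depth, ← Set.ncard_singleton r]
  refine Set.ncard_le_ncard (fun x hx => ?_) (Set.finite_singleton r)
  rcases RTree.mem_pathSet_node.1 hx with ⟨-, h⟩ | ⟨t, ht, h, -⟩
  · exact h
  · exact absurd h (root_notMem_vertSet_child hts ht)

lemma depth_node_le [Finite V]
    (hts : ∀ t ∈ ts, IsSearchTree G (compIn G (s \ {r}) t.root) t)
    (hpw : ts.Pairwise fun t₁ t₂ => compIn G (s \ {r}) t₁.root ≠ compIn G (s \ {r}) t₂.root)
    {t : RTree V} (ht : t ∈ ts) {v : V} (hv : v ∈ t.vertSet) :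
    (RTree.node r ts).depth v ≤ t.depth v + 1 := by
  refine (Set.ncard_le_ncard (fun x hx => ?_) (Set.toFinite _)).trans
    (Set.ncard_insert_le r (t.pathSet v))
  rcases RTree.mem_pathSet_node.1 hx with ⟨-, h⟩ | ⟨t', ht', hv', h⟩
  · exact Or.inl h
  · obtain rfl := eq_of_mem_vertSet_children hts hpw ht ht' hv hv'
    exact h

end children

/-- A centroid tree on `s` costs at most twice what is paid inside `s` by any assignment `P` of
ancestor sets in which every connected set has a common ancestor of its own. -/
lemma cost_centroid_le [Finite V] {G : SimpleGraph V} {w : V → ℝ} (hw : ∀ x, 0 ≤ w x)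
    {P : V → Set V} (hself : ∀ v, v ∈ P v)
    (hP : ∀ H, ConnIn G H → ∃ a ∈ H, ∀ v ∈ H, a ∈ P v)
    {s : Set V} {C : RTree V} (hC : IsSearchTree G s C) (hs : ConnIn G s)
    (hcent : ∀ t ∈ C.allSubtrees, IsCentroid G w t.vertSet t.root) :
    cost w C ≤ 2 * wsum (fun v => w v * ((P v ∩ s).ncard : ℝ)) s - wsum w s := by
  classical
  induction hC with
  | @node s r ts hr hvs hts hpw ih =>
  obtain ⟨a, ha, haP⟩ := hP s hs
  set D : V → ℝ := fun v => w v * ((RTree.node r ts).depth v : ℝ)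
  set B : V → ℝ := fun v => w v * ((P v ∩ s).ncard : ℝ)
  have hsum (f : V → ℝ) : wsum f s = f r + ∑ t ∈ ts.toFinset, wsum f t.vertSet :=
    hvs ▸ wsum_vertSet_node hts hpw f
  have hcost : cost w (RTree.node r ts) = wsum D s := by rw [← hvs]; rfl
  have hts_sub (t) (ht : t ∈ ts) : t.vertSet ⊆ s \ {r} :=
    (hts t ht).vertSet_eq ▸ compIn_subset
  have hroot (t) (ht : t ∈ ts) : t.root ∈ s \ {r} := compIn_subset (hts t ht).root_mem
  have hchild (t) (ht : t ∈ ts) : wsum D t.vertSet ≤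
      2 * wsum (fun v => w v * ((P v ∩ t.vertSet).ncard : ℝ)) t.vertSet := by
    have h := ih t ht (connIn_compIn (hroot t ht))
      fun u hu => hcent u (RTree.mem_allSubtrees_node ht hu)
    rw [← (hts t ht).vertSet_eq] at h
    have h' : wsum D t.vertSet ≤ wsum (fun v => w v * (t.depth v : ℝ) + w v) t.vertSet :=
      wsum_mono fun v hv => by
        have : ((RTree.node r ts).depth v : ℝ) ≤ t.depth v + 1 := by
          exact_mod_cast depth_node_le hts hpw ht hv
        nlinarith [mul_le_mul_of_nonneg_left this (hw v)]
    rw [wsum_add] at h'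
    change wsum (fun v => w v * (t.depth v : ℝ)) t.vertSet ≤ _ at h
    linarith
  have hle (t) (ht : t ∈ ts) : wsum D t.vertSet ≤ 2 * wsum B t.vertSet := by
    refine (hchild t ht).trans (mul_le_mul_of_nonneg_left (wsum_mono fun v _ => ?_) zero_le_two)
    refine mul_le_mul_of_nonneg_left (Nat.cast_le.2 ?_) (hw v)
    exact Set.ncard_le_ncard
      (Set.inter_subset_inter_right _ ((hts_sub t ht).trans Set.sdiff_subset)) (Set.toFinite _)
  have hgain (t) (ht : t ∈ ts) (hat : a ∉ t.vertSet) :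
      wsum D t.vertSet ≤ 2 * wsum B t.vertSet - 2 * wsum w t.vertSet := by
    have h : wsum (fun v => w v * ((P v ∩ t.vertSet).ncard : ℝ) + w v) t.vertSet ≤
        wsum B t.vertSet := wsum_mono fun v hv => by
      have hsub : insert a (P v ∩ t.vertSet) ⊆ P v ∩ s := by
        refine Set.insert_subset ⟨haP v (hts_sub t ht hv).1, ha⟩ ?_
        exact Set.inter_subset_inter_right _ ((hts_sub t ht).trans Set.sdiff_subset)
      have hc := Set.ncard_le_ncard hsub (Set.toFinite _)
      rw [Set.ncard_insert_of_notMem (fun h => hat h.2) (Set.toFinite _)] at hc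
      have hc' : ((P v ∩ t.vertSet).ncard : ℝ) + 1 ≤ (P v ∩ s).ncard := by exact_mod_cast hc
      nlinarith [mul_le_mul_of_nonneg_left hc' (hw v)]
    rw [wsum_add] at h
    linarith [hchild t ht]
  have hDr : D r ≤ w r := by
    have : ((RTree.node r ts).depth r : ℝ) ≤ 1 := by exact_mod_cast depth_node_root_le hts
    exact mul_le_of_le_one_right (hw r) this
  have hW (t) : 0 ≤ wsum w t := finsum_nonneg fun v => finsum_nonneg fun _ => hw v
  rw [hcost, hsum D, hsum B, hsum w]
  by_cases har : a = r
  · have hBr : w r ≤ B r := by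
      have : 0 < (P r ∩ s).ncard := (Set.ncard_pos (Set.toFinite _)).2 ⟨r, hself r, hr⟩
      exact le_mul_of_one_le_right (hw r) (by exact_mod_cast this)
    have h := Finset.sum_le_sum fun t (ht : t ∈ ts.toFinset) =>
      hgain t (List.mem_toFinset.1 ht)
        (har ▸ root_notMem_vertSet_child hts (List.mem_toFinset.1 ht))
    rw [Finset.sum_sub_distrib, ← Finset.mul_sum, ← Finset.mul_sum] at h
    have := Finset.sum_nonneg fun t (_ : t ∈ ts.toFinset) => hW t.vertSet
    linarith
  · have hBr : 2 * w r ≤ B r := by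
      have hsub : ({a, r} : Set V) ⊆ P r ∩ s :=
        Set.insert_subset ⟨haP r hr, ha⟩ (Set.singleton_subset_iff.2 ⟨hself r, hr⟩)
      have hc := Set.ncard_le_ncard hsub (Set.toFinite _)
      rw [Set.ncard_pair har] at hc
      have hc' : (2 : ℝ) ≤ (P r ∩ s).ncard := by exact_mod_cast hc
      nlinarith [mul_le_mul_of_nonneg_left hc' (hw r)]
    obtain h | ⟨t₀, ht₀, hat₀⟩ := RTree.mem_vertSet_node.1 (hvs.symm ▸ ha)
    · exact absurd h har
    have hcr := (hcent _ (RTree.self_mem_allSubtrees _)).2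
    simp only [RTree.root, hvs] at hcr
    have hc := hcr _ (hroot t₀ ht₀)
    rw [← (hts t₀ ht₀).vertSet_eq, hsum w] at hc
    have hmem : t₀ ∈ ts.toFinset := List.mem_toFinset.2 ht₀
    have h := Finset.sum_le_sum fun t (ht : t ∈ ts.toFinset.erase t₀) => by
      obtain ⟨hne, ht⟩ := Finset.mem_erase.1 ht
      have ht := List.mem_toFinset.1 ht
      exact hgain t ht fun hat => hne (eq_of_mem_vertSet_children hts hpw ht ht₀ hat hat₀)
    rw [Finset.sum_sub_distrib, ← Finset.mul_sum, ← Finset.mul_sum] at h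
    rw [← Finset.add_sum_erase _ _ hmem] at hc
    simp only [← Finset.add_sum_erase _ _ hmem]
    linarith [hle t₀ ht₀, hw r]

theorem centroid_tree_two_approx {V : Type} [Fintype V]
    (G : SimpleGraph V) (hG : G.IsTree) (w : V → ℝ) (hw : ∀ x, 0 ≤ w x)
    (C : RTree V) (hC : IsCentroidTree G w Set.univ C) :
    cost w C ≤ 2 * OPT G w Set.univ - wsum w Set.univ := by
  have hconn : ConnIn G Set.univ := by
    obtain ⟨v⟩ := hG.1.nonempty
    exact ⟨⟨v, trivial⟩, fun x _ y _ =>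
      let ⟨p⟩ := hG.1.preconnected x y
      ⟨p, fun _ _ => trivial⟩⟩
  suffices h : (cost w C + wsum w Set.univ) / 2 ≤ OPT G w Set.univ by linarith
  refine le_csInf ⟨_, C, hC.1, rfl⟩ ?_
  rintro _ ⟨T, hT, rfl⟩
  have h := cost_centroid_le hw (fun v => hT.self_mem_pathSet v trivial)
    (fun H hH => hT.exists_common_ancestor hH H.subset_univ) hC.1 hconn hC.2
  have hcost : cost w T =
      wsum (fun v => w v * ((T.pathSet v ∩ Set.univ).ncard : ℝ)) Set.univ := by
    simp only [Set.inter_univ]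
    rw [cost, hT.vertSet_eq]
    rfl
  linarith
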